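/- For every n ≥ 2, the n-dimensional globular cell is a po-space. Precisely, let D^{n-1} = {x ∈ ℝ^{n-1} : ‖x‖ ≤ 1} be the closed unit disk and S^{n-2} = {x ∈ ℝ^{n-1} : ‖x‖ = 1} its boundary sphere. The subspace E := {q(x,t) ∈ Glob(D^{n-1}) : ‖x‖ < 1 and 0 < t < 1} of Glob(D^{n-1}) (obtained by removing the image of S^{n-2} × [0,1] together with the points ι and σ), equipped with the partial order induced from Glob(D^{n-1}), has closed graph {(a,b) ∈ E × E : a ≤ b} in E × E; hence it is a po-space. -/

import Mathlib

universe u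

/-- The relation on `X × [0,1]` identifying `(x,0) ∼ (x',0)` and `(x,1) ∼ (x',1)`. -/
def globR (X : Type u) : X × unitInterval → X × unitInterval → Prop :=
  fun p q => (p.2 = 0 ∧ q.2 = 0) ∨ (p.2 = 1 ∧ q.2 = 1)

/-- The Globe of a topological space `X` : the quotient of `X × [0,1]` by the
identifications `(x,0) ∼ (x',0)` and `(x,1) ∼ (x',1)`. -/
def Glob (X : Type u) : Type u := Quot (globR X)

/-- The quotient topology on `Glob X`. -/
instance (X : Type u) [TopologicalSpace X] : TopologicalSpace (Glob X) :=
  TopologicalSpace.coinduced (Quot.mk (globR X)) inferInstance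

/-- The quotient map `q : X × [0,1] → Glob X`. -/
def globQ {X : Type u} (p : X × unitInterval) : Glob X := Quot.mk (globR X) p

/-- The relation `≤` on `Glob X` : `a ≤ b` iff there are `x ∈ X` and `t ≤ t'` in `[0,1]`
with `a = q(x,t)` and `b = q(x,t')`. -/
def globLe {X : Type u} (a b : Glob X) : Prop :=
  ∃ (x : X) (t t' : unitInterval), t ≤ t' ∧ a = globQ (x, t) ∧ b = globQ (x, t')

/-- The closed unit disk `D^m` in `ℝ^m`. -/
abbrev Disk (m : ℕ) : Type := {x : EuclideanSpace ℝ (Fin m) // ‖x‖ ≤ 1}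

/-- The `n`-dimensional globular cell (here with `m = n-1`) : the subspace of
`Glob(D^m)` consisting of the classes `q(x,t)` with `‖x‖ < 1` and `0 < t < 1`. -/
def globCell (m : ℕ) : Set (Glob (Disk m)) :=
  {a | ∃ (x : Disk m) (t : unitInterval),
    ‖(x : EuclideanSpace ℝ (Fin m))‖ < 1 ∧ 0 < t ∧ t < 1 ∧ a = globQ (x, t)}

/-- The height `q(x,t) ↦ t` on the Globe. -/
def globHeight {X : Type u} : Glob X → unitInterval :=
  Quot.lift Prod.snd fun _ _ h => by
    rcases h with ⟨h, h'⟩ | ⟨h, h'⟩ <;> rw [h, h']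

/-- The map `q(x,t) ↦ t(1-t)x` on the Globe of a disk. -/
noncomputable def globScaled {m : ℕ} : Glob (Disk m) → EuclideanSpace ℝ (Fin m) :=
  Quot.lift (fun p => ((p.2 : ℝ) * (1 - p.2)) • (p.1 : EuclideanSpace ℝ (Fin m))) fun _ _ h => by
    rcases h with ⟨h, h'⟩ | ⟨h, h'⟩ <;> simp [h, h']

/-- The map which sends `q(x,t)` to `x` when `0 < t < 1`. -/
noncomputable def globBase {m : ℕ} (a : Glob (Disk m)) : EuclideanSpace ℝ (Fin m) :=
  ((globHeight a : ℝ) * (1 - globHeight a))⁻¹ • globScaled a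

theorem continuous_globHeight {X : Type u} [TopologicalSpace X] :
    Continuous (globHeight : Glob X → unitInterval) :=
  continuous_coinduced_dom.2 continuous_snd

theorem continuous_globScaled {m : ℕ} :
    Continuous (globScaled : Glob (Disk m) → EuclideanSpace ℝ (Fin m)) := by
  refine continuous_coinduced_dom.2 ?_
  change Continuous fun p : Disk m × unitInterval =>
    ((p.2 : ℝ) * (1 - p.2)) • (p.1 : EuclideanSpace ℝ (Fin m))
  fun_prop

theorem unitInterval_mul_one_sub_ne_zero {t : unitInterval} (h0 : 0 < t) (h1 : t < 1) :
    (t : ℝ) * (1 - t) ≠ 0 := by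
  have h0' : (0 : ℝ) < t := h0
  have h1' : (t : ℝ) < 1 := h1
  exact (mul_pos h0' (sub_pos.2 h1')).ne'

theorem globBase_globQ {m : ℕ} (x : Disk m) {t : unitInterval} (h0 : 0 < t) (h1 : t < 1) :
    globBase (globQ (x, t)) = x :=
  inv_smul_smul₀ (unitInterval_mul_one_sub_ne_zero h0 h1) _

theorem globHeight_mem_Ioo {m : ℕ} {a : Glob (Disk m)} (ha : a ∈ globCell m) :
    0 < globHeight a ∧ globHeight a < 1 := by
  obtain ⟨x, t, -, h0, h1, rfl⟩ := ha
  exact ⟨h0, h1⟩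

theorem continuous_globBase_globCell {m : ℕ} :
    Continuous fun a : globCell m => globBase (a : Glob (Disk m)) := by
  have hh : Continuous fun a : globCell m => (globHeight (a : Glob (Disk m)) : ℝ) :=
    continuous_subtype_val.comp (continuous_globHeight.comp continuous_subtype_val)
  refine ((hh.mul (continuous_const.sub hh)).inv₀ fun a => ?_).smul
    (continuous_globScaled.comp continuous_subtype_val)
  exact unitInterval_mul_one_sub_ne_zero (globHeight_mem_Ioo a.2).1 (globHeight_mem_Ioo a.2).2

theorem globCell_ext {m : ℕ} {a b : globCell m}
    (hh : globHeight (a : Glob (Disk m)) = globHeight (b : Glob (Disk m)))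
    (hb : globBase (a : Glob (Disk m)) = globBase (b : Glob (Disk m))) : a = b := by
  revert hh hb
  obtain ⟨_, x, t, -, ht0, ht1, rfl⟩ := a
  obtain ⟨_, y, s, -, hs0, hs1, rfl⟩ := b
  intro hh hb
  rw [globBase_globQ x ht0 ht1, globBase_globQ y hs0 hs1] at hb
  have hts : t = s := hh
  have hxy : x = y := Subtype.ext hb
  subst hts hxy
  rfl

/-- On the globular cell, the order of the Globe compares heights over the same base point. -/
theorem globLe_iff {m : ℕ} (a b : globCell m) :
    globLe (a : Glob (Disk m)) (b : Glob (Disk m)) ↔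
      globHeight (a : Glob (Disk m)) ≤ globHeight (b : Glob (Disk m)) ∧
        globBase (a : Glob (Disk m)) = globBase (b : Glob (Disk m)) := by
  constructor
  · rintro ⟨x, t, s, hts, ha, hb⟩
    have hA := globHeight_mem_Ioo a.2
    have hB := globHeight_mem_Ioo b.2
    rw [ha] at hA ⊢
    rw [hb] at hB ⊢
    exact ⟨hts, (globBase_globQ x hA.1 hA.2).trans (globBase_globQ x hB.1 hB.2).symm⟩
  · obtain ⟨_, x, t, -, ht0, ht1, rfl⟩ := a
    obtain ⟨_, y, s, -, hs0, hs1, rfl⟩ := b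
    rintro ⟨hts, hb⟩
    rw [globBase_globQ x ht0 ht1, globBase_globQ y hs0 hs1] at hb
    obtain rfl : x = y := Subtype.ext hb
    exact ⟨x, t, s, hts, rfl, rfl⟩

/-- for `n ≥ 2`, the `n`-dimensional globular cell
`E = {q(x,t) ∈ Glob(D^{n-1}) : ‖x‖ < 1, 0 < t < 1}`, equipped with the partial order
induced from `Glob(D^{n-1})`, is a po-space : the induced relation is a partial order
on `E` and its graph is closed in `E × E`. -/
theorem stmt_1 (n : ℕ) (hn : 2 ≤ n) :
    (∀ a : globCell (n-1), globLe (a : Glob (Disk (n-1))) (a : Glob (Disk (n-1)))) ∧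
    (∀ a b c : globCell (n-1),
      globLe (a : Glob (Disk (n-1))) (b : Glob (Disk (n-1))) →
      globLe (b : Glob (Disk (n-1))) (c : Glob (Disk (n-1))) →
      globLe (a : Glob (Disk (n-1))) (c : Glob (Disk (n-1)))) ∧
    (∀ a b : globCell (n-1),
      globLe (a : Glob (Disk (n-1))) (b : Glob (Disk (n-1))) →
      globLe (b : Glob (Disk (n-1))) (a : Glob (Disk (n-1))) → a = b) ∧
    IsClosed {p : globCell (n-1) × globCell (n-1) |
      globLe (p.1 : Glob (Disk (n-1))) (p.2 : Glob (Disk (n-1)))} := by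
  simp only [globLe_iff]
  refine ⟨fun a => ⟨le_rfl, trivial⟩,
    fun a b c hab hbc => ⟨hab.1.trans hbc.1, hab.2.trans hbc.2⟩,
    fun a b hab hba => globCell_ext (le_antisymm hab.1 hba.1) hab.2, ?_⟩
  have hh : Continuous fun a : globCell (n-1) => globHeight (a : Glob (Disk (n-1))) :=
    continuous_globHeight.comp continuous_subtype_val
  exact (isClosed_le (hh.comp continuous_fst) (hh.comp continuous_snd)).inter
    (isClosed_eq (continuous_globBase_globCell.comp continuous_fst)
      (continuous_globBase_globCell.comp continuous_snd))
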